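/- arXiv:math/0605565 — 2 statements merged into one kernel-verified Lean document; each statement's English description precedes it below -/
import Mathlib

section
/- For every real α > 1, every real β > 0 and every real k ≥ 0, one has the identity Σ_{n=1}^∞ μ(n) n^{-α} e^{-k/n^β} = e^{-k} Σ_{p=0}^∞ c_p(α,β) k^p / p!, where both series converge absolutely; i.e. the 'exponential' coefficients are the Poisson-distribution average of the coefficients c_p(α,β). -/
open ArithmeticFunction

/-- The coefficient `c_p(α,β) = ∑_{n=1}^∞ μ(n) n^{-α} (1 - n^{-β})^p`. -/
noncomputable def cCoeff (α β : ℝ) (p : ℕ) : ℝ :=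
  ∑' n : ℕ, (moebius n : ℝ) * (n : ℝ) ^ (-α) * (1 - (n : ℝ) ^ (-β)) ^ p

lemma summable_moebius_mul_rpow_neg {α : ℝ} (hα : 1 < α) :
    Summable fun n : ℕ => |(moebius n : ℝ) * (n : ℝ) ^ (-α)| := by
  refine Summable.of_nonneg_of_le (fun n => abs_nonneg _) (fun n => ?_)
    (Real.summable_nat_rpow.mpr (neg_lt_neg hα))
  have hn : (0 : ℝ) ≤ (n : ℝ) ^ (-α) := by positivity
  rw [abs_mul, abs_of_nonneg hn]
  exact mul_le_of_le_one_left hn (mod_cast abs_moebius_le_one)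

lemma abs_one_sub_natCast_rpow_neg_le_one {β : ℝ} (hβ : 0 < β) (n : ℕ) :
    |1 - (n : ℝ) ^ (-β)| ≤ 1 := by
  have h0 : (0 : ℝ) ≤ (n : ℝ) ^ (-β) := by positivity
  have h1 : (n : ℝ) ^ (-β) ≤ 1 := by
    rcases Nat.eq_zero_or_pos n with rfl | hn
    · simp [Real.zero_rpow (neg_ne_zero.mpr hβ.ne')]
    · exact Real.rpow_le_one_of_one_le_of_nonpos (mod_cast hn) (neg_nonpos.mpr hβ.le)
  rw [abs_le]
  constructor <;> linarith

/-- The double series behind the interchange of summations converges absolutely. -/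
lemma summable_mul_pow_mul_pow_div_factorial {a x : ℕ → ℝ} (ha : Summable fun n => |a n|)
    (hx : ∀ n, |x n| ≤ 1) (k : ℝ) :
    Summable fun q : ℕ × ℕ => a q.1 * x q.1 ^ q.2 * (k ^ q.2 / (Nat.factorial q.2 : ℝ)) := by
  have hk : Summable fun p : ℕ => |k| ^ p / (Nat.factorial p : ℝ) :=
    Real.summable_pow_div_factorial |k|
  refine Summable.of_norm_bounded
    (ha.mul_of_nonneg hk (fun n => abs_nonneg _) (fun p => by positivity)) fun q => ?_
  rw [Real.norm_eq_abs, abs_mul, abs_mul, abs_div, abs_pow, abs_pow, Nat.abs_cast]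
  exact mul_le_mul_of_nonneg_right
    (mul_le_of_le_one_right (abs_nonneg _) (pow_le_one₀ (abs_nonneg _) (hx q.1))) (by positivity)

lemma moebius_mul_exp_neg_div_rpow (α β k : ℝ) (n : ℕ) :
    (moebius n : ℝ) * (n : ℝ) ^ (-α) * Real.exp (-k / (n : ℝ) ^ β) =
      Real.exp (-k) * ∑' p : ℕ, (moebius n : ℝ) * (n : ℝ) ^ (-α) * (1 - (n : ℝ) ^ (-β)) ^ p *
        (k ^ p / (Nat.factorial p : ℝ)) := by
  have hsum : ∑' p : ℕ, (moebius n : ℝ) * (n : ℝ) ^ (-α) * (1 - (n : ℝ) ^ (-β)) ^ p *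
      (k ^ p / (Nat.factorial p : ℝ)) =
      (moebius n : ℝ) * (n : ℝ) ^ (-α) * Real.exp ((1 - (n : ℝ) ^ (-β)) * k) := by
    rw [Real.exp_eq_exp_ℝ, NormedSpace.exp_eq_tsum_div, ← tsum_mul_left]
    refine tsum_congr fun p => ?_
    rw [mul_pow]
    ring
  rw [hsum, mul_left_comm, ← Real.exp_add, Real.rpow_neg n.cast_nonneg β]
  congr 2
  ring

/-- For `α > 1`, `β > 0` and real `k ≥ 0`:
`∑_{n=1}^∞ μ(n) n^{-α} e^{-k/n^β} = e^{-k} ∑_{p=0}^∞ c_p(α,β) k^p / p!`,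
both series converging absolutely. -/
theorem exp_coeff_eq_poisson_average (α β k : ℝ) (hα : 1 < α) (hβ : 0 < β) (hk : 0 ≤ k) :
    (Summable fun n : ℕ => |(moebius n : ℝ) * (n : ℝ) ^ (-α) * Real.exp (-k / (n : ℝ) ^ β)|) ∧
    (Summable fun p : ℕ => |cCoeff α β p * k ^ p / (Nat.factorial p : ℝ)|) ∧
    (∑' n : ℕ, (moebius n : ℝ) * (n : ℝ) ^ (-α) * Real.exp (-k / (n : ℝ) ^ β)) =
      Real.exp (-k) * ∑' p : ℕ, cCoeff α β p * k ^ p / (Nat.factorial p : ℝ) := by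
  set a : ℕ → ℝ := fun n => (moebius n : ℝ) * (n : ℝ) ^ (-α)
  set x : ℕ → ℝ := fun n => 1 - (n : ℝ) ^ (-β)
  have ha : Summable fun n => |a n| := summable_moebius_mul_rpow_neg hα
  have hF := summable_mul_pow_mul_pow_div_factorial ha
    (abs_one_sub_natCast_rpow_neg_le_one hβ) k
  have hc (p : ℕ) : cCoeff α β p * k ^ p / (Nat.factorial p : ℝ) =
      ∑' n : ℕ, a n * x n ^ p * (k ^ p / (Nat.factorial p : ℝ)) := by
    rw [tsum_mul_right, mul_div_assoc]
    rfl
  refine ⟨?_, ?_, ?_⟩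
  · refine Summable.of_nonneg_of_le (fun n => abs_nonneg _) (fun n => ?_) ha
    rw [abs_mul, Real.abs_exp]
    refine mul_le_of_le_one_right (abs_nonneg _) (Real.exp_le_one_iff.mpr ?_)
    exact div_nonpos_of_nonpos_of_nonneg (neg_nonpos.mpr hk) (by positivity)
  · simp only [hc]
    exact hF.prod_symm.prod.abs
  · simp only [hc]
    rw [tsum_congr (moebius_mul_exp_neg_div_rpow α β k), tsum_mul_left]
    congr 1
    exact hF.tsum_comm.symm
end

section
/- (Mellin integral representation of the Riesz function.) For every real x > 0 and every real a with 1/2 < a < 1, the Riesz function admits the absolutely convergent vertical-line integral representation F(x) = (1/(2π)) ∫_{-∞}^{∞} Γ(1 - (a+it)) · x^{a+it} / ζ(2(a+it)) dt, i.e. F(x) = (1/(2πi)) ∫_{a-i∞}^{a+i∞} Γ(1-s) x^s / ζ(2s) ds. -/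
open MeasureTheory Complex

open scoped ArithmeticFunction.Moebius

theorem Complex.norm_Gamma_le_Gamma_re {s : ℂ} (hs : 0 < s.re) :
    ‖Gamma s‖ ≤ Real.Gamma s.re := by
  rw [Gamma_eq_integral hs, GammaIntegral, Real.Gamma_eq_integral hs]
  refine (norm_integral_le_integral_norm _).trans_eq ?_
  refine setIntegral_congr_fun measurableSet_Ioi fun t ht ↦ ?_
  simp only [norm_mul, norm_cpow_eq_rpow_re_of_pos ht, sub_re, one_re, norm_real,
    Real.norm_eq_abs, abs_of_pos (Real.exp_pos _)]

theorem Complex.norm_Gamma_le_Gamma_add_two_div {σ : ℝ} (hσ : 0 < σ) (t : ℝ) :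
    ‖Gamma (σ + t * I)‖ ≤ Real.Gamma (σ + 2) / (σ ^ 2 + t ^ 2) := by
  set s : ℂ := σ + t * I with hs
  have hre : s.re = σ := by simp [hs]
  have him : s.im = t := by simp [hs]
  have h0 : s ≠ 0 := fun h ↦ by simp [h] at hre; linarith
  have h1 : s + 1 ≠ 0 := fun h ↦ by
    have := congrArg re h
    simp [hre] at this; linarith
  have hG : Gamma (s + 2) = (s + 1) * s * Gamma s := by
    rw [show s + 2 = (s + 1) + 1 by ring, Gamma_add_one _ h1, Gamma_add_one _ h0, mul_assoc]
  have hb : ‖Gamma (s + 2)‖ ≤ Real.Gamma (σ + 2) := by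
    simpa [hre] using norm_Gamma_le_Gamma_re (s := s + 2) (by simp [hre]; linarith)
  have hss : ‖s‖ ^ 2 = σ ^ 2 + t ^ 2 := by
    rw [← normSq_eq_norm_sq, normSq_apply, hre, him]; ring
  have hs1 : ‖s‖ ≤ ‖s + 1‖ := by
    rw [← sq_le_sq₀ (norm_nonneg _) (norm_nonneg _), hss, ← normSq_eq_norm_sq, normSq_apply]
    simp [hre, him]; nlinarith
  rw [le_div_iff₀ (by positivity), ← hss]
  calc ‖Gamma s‖ * ‖s‖ ^ 2 = ‖s‖ * ‖s‖ * ‖Gamma s‖ := by ring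
    _ ≤ ‖s + 1‖ * ‖s‖ * ‖Gamma s‖ := by gcongr
    _ = ‖Gamma (s + 2)‖ := by rw [hG, norm_mul, norm_mul]
    _ ≤ _ := hb

theorem Complex.continuous_Gamma_vertical {σ : ℝ} (hσ : 0 < σ) :
    Continuous fun t : ℝ ↦ Gamma (σ + t * I) := by
  refine continuous_iff_continuousAt.2 fun t ↦ ?_
  refine ContinuousAt.comp (g := Gamma) (differentiableAt_Gamma _ fun m h ↦ ?_).continuousAt
    (by fun_prop)
  have := congrArg re h
  simp at this
  have : (0 : ℝ) ≤ m := m.cast_nonneg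
  linarith

theorem Complex.verticalIntegrable_Gamma {σ : ℝ} (hσ : 0 < σ) : VerticalIntegrable Gamma σ := by
  have hi : Integrable fun t : ℝ ↦ (σ ^ 2 + t ^ 2)⁻¹ := by
    have := (integrable_inv_one_add_sq.comp_div hσ.ne').const_mul (σ ^ 2)⁻¹
    refine this.congr (.of_forall fun t ↦ ?_)
    simp only [← mul_inv]
    congr 1
    field_simp
  refine (hi.const_mul (Real.Gamma (σ + 2))).mono'
    (continuous_Gamma_vertical hσ).aestronglyMeasurable (.of_forall fun t ↦ ?_)
  simpa [div_eq_mul_inv] using norm_Gamma_le_Gamma_add_two_div hσ t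

/-- The Cahen–Mellin integral. -/
theorem Complex.mellinInv_Gamma {σ y : ℝ} (hσ : 0 < σ) (hy : 0 < y) :
    mellinInv σ Gamma y = exp (-y) := by
  have hG {s : ℂ} (hs : 0 < s.re) : mellin (fun t : ℝ ↦ (Real.exp (-t) : ℂ)) s = Gamma s := by
    rw [Gamma_eq_integral hs, GammaIntegral_eq_mellin]
  have hline (t : ℝ) : mellin (fun t : ℝ ↦ (Real.exp (-t) : ℂ)) (σ + t * I) = Gamma (σ + t * I) :=
    hG (by simpa using hσ)
  have hconv : MellinConvergent (fun t : ℝ ↦ (Real.exp (-t) : ℂ)) σ := by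
    have := GammaIntegral_convergent (s := σ) (by simpa using hσ)
    refine this.congr_fun (fun t _ ↦ ?_) measurableSet_Ioi
    simp [mul_comm]
  have := mellinInv_mellin_eq σ (fun t : ℝ ↦ (Real.exp (-t) : ℂ)) hy hconv
    (by simpa only [VerticalIntegrable, hline] using verticalIntegrable_Gamma hσ)
    (by fun_prop)
  simp only [mellinInv, hline] at this
  simpa only [mellinInv, ofReal_exp, ofReal_neg] using this

theorem integrable_Gamma_one_sub {a : ℝ} (ha : a < 1) :
    Integrable fun t : ℝ ↦ Gamma (1 - ((a : ℂ) + t * I)) := by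
  refine (verticalIntegrable_Gamma (sub_pos.2 ha)).comp_neg.congr (.of_forall fun t ↦ ?_)
  simp only [ofReal_sub, ofReal_one, ofReal_neg]
  congr 1; ring

theorem integral_Gamma_one_sub_mul_cpow {a y : ℝ} (ha : a < 1) (hy : 0 < y) :
    (1 / (2 * Real.pi) : ℂ) *
      ∫ t : ℝ, Gamma (1 - ((a : ℂ) + t * I)) * (y : ℂ) ^ ((a : ℂ) + t * I) =
        y * exp (-y) := by
  have hy' : (y : ℂ) ≠ 0 := ofReal_ne_zero.2 hy.ne'
  rw [← mellinInv_Gamma (sub_pos.2 ha) hy, mellinInv,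
    ← integral_neg_eq_self (fun t : ℝ ↦ (y : ℂ) ^ (-(((1 - a : ℝ) : ℂ) + t * I)) • _)]
  rw [real_smul, mul_left_comm, ← integral_const_mul (y : ℂ)]
  push_cast
  refine congrArg _ (integral_congr_ae (.of_forall fun t ↦ ?_))
  beta_reduce
  rw [show -(1 - (a : ℂ) + -t * I) = (a + t * I) - 1 by ring, cpow_sub _ _ hy', cpow_one,
    show (1 : ℂ) - a + -t * I = 1 - (a + t * I) by ring]
  simp only [smul_eq_mul]
  field_simp

theorem hasSum_moebius_term_riemannZeta_inv {s : ℂ} (hs : 1 < s.re) :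
    HasSum (LSeries.term (fun n ↦ (μ n : ℂ)) s) (riemannZeta s)⁻¹ := by
  have h := (ArithmeticFunction.LSeriesSummable_moebius_iff.2 hs).LSeriesHasSum
  have h1 := ArithmeticFunction.LSeries_zeta_mul_Lseries_moebius hs
  rw [ArithmeticFunction.LSeries_zeta_eq_riemannZeta hs] at h1
  rwa [eq_inv_of_mul_eq_one_right h1] at h

theorem norm_moebius_term_le (s : ℂ) (n : ℕ) :
    ‖LSeries.term (fun n ↦ (μ n : ℂ)) s n‖ ≤ 1 / (n : ℝ) ^ s.re := by
  rw [LSeries.norm_term_eq]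
  split_ifs
  · positivity
  · gcongr
    rw [norm_intCast]
    exact_mod_cast ArithmeticFunction.abs_moebius_le_one

/-- The Riesz function as a sum over the Möbius function. -/
theorem tsum_riesz_eq_tsum_moebius (x : ℝ) :
    (∑' k : ℕ, (-1 : ℂ) ^ (k + 2) * (x : ℂ) ^ (k + 1) /
        ((Nat.factorial k : ℂ) * riemannZeta (2 * ((k : ℂ) + 1)))) =
      ∑' n : ℕ, (μ n : ℂ) * ((x / n ^ 2 : ℝ) * exp (-(x / n ^ 2 : ℝ))) := by
  have hre (k : ℕ) : (2 * ((k : ℂ) + 1)).re = 2 * (k + 1) := by simp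
  let c (k : ℕ) : ℂ := (-1) ^ k * (x : ℂ) ^ (k + 1) / Nat.factorial k
  let f (k n : ℕ) : ℂ := c k * LSeries.term (fun n ↦ (μ n : ℂ)) (2 * ((k : ℂ) + 1)) n
  have hf : Summable (Function.uncurry f) := by
    have h1 : Summable fun k : ℕ ↦ |x| * (|x| ^ k / Nat.factorial k) :=
      (Real.summable_pow_div_factorial |x|).mul_left _
    have h2 : Summable fun n : ℕ ↦ 1 / (n : ℝ) ^ 2 :=
      Real.summable_one_div_nat_pow.2 one_lt_two
    refine (h1.mul_of_nonneg h2 (fun _ ↦ by positivity) (fun _ ↦ by positivity)).of_norm_bounded ?_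
    rintro ⟨k, n⟩
    simp only [Function.uncurry, f, norm_mul]
    gcongr
    · simp [c]
      exact le_of_eq (by ring)
    · rcases eq_or_ne n 0 with rfl | hn
      · simp
      refine (norm_moebius_term_le _ _).trans ?_
      have hn1 : (1 : ℝ) ≤ n := by exact_mod_cast Nat.one_le_iff_ne_zero.2 hn
      rw [hre]
      gcongr
      rw [← Real.rpow_natCast]
      gcongr
      push_cast
      have : (0 : ℝ) ≤ k := k.cast_nonneg
      linarith
  calc _ = ∑' k, ∑' n, f k n := by
        refine tsum_congr fun k ↦ ?_
        rw [tsum_mul_left, (hasSum_moebius_term_riemannZeta_inv ?_).tsum_eq]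
        · simp only [c, pow_add (-1 : ℂ) k 2]
          field_simp
        · rw [hre]
          have : (0 : ℝ) ≤ k := k.cast_nonneg
          linarith
    _ = ∑' n, ∑' k, f k n := hf.tsum_comm.symm
    _ = _ := by
        refine tsum_congr fun n ↦ ?_
        rcases eq_or_ne n 0 with rfl | hn
        · simp [f]
        have hn' : (n : ℂ) ≠ 0 := by exact_mod_cast hn
        rw [exp_eq_exp_ℂ, NormedSpace.exp_eq_tsum_div, ← tsum_mul_left, ← tsum_mul_left]
        refine tsum_congr fun k ↦ ?_
        have hp : (n : ℂ) ^ (2 * ((k : ℂ) + 1)) = ((n : ℂ) ^ 2) ^ (k + 1) := by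
          rw [← pow_mul, ← cpow_natCast]
          push_cast
          rfl
        simp only [f, c, LSeries.term_of_ne_zero hn, hp]
        push_cast
        rw [neg_pow ((x : ℂ) / n ^ 2), div_pow]
        field_simp
        ring

/-- Mellin integral representation of the Riesz function: for `x > 0` and
`1/2 < a < 1`,
`F(x) = (1/(2π)) ∫_ℝ Γ(1-(a+it)) x^{a+it} / ζ(2(a+it)) dt`,
the integral being absolutely convergent, where
`F(x) = ∑_{k=1}^∞ (-1)^{k+1} x^k / ((k-1)! ζ(2k))`. -/
theorem riesz_function_mellin_repr (x a : ℝ) (hx : 0 < x) (ha : 1 / 2 < a) (ha' : a < 1) :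
    Integrable (fun t : ℝ =>
      Complex.Gamma (1 - ((a : ℂ) + t * I)) * (x : ℂ) ^ ((a : ℂ) + t * I) /
        riemannZeta (2 * ((a : ℂ) + t * I))) ∧
    (∑' k : ℕ, (-1 : ℂ) ^ (k + 2) * (x : ℂ) ^ (k + 1) /
        ((Nat.factorial k : ℂ) * riemannZeta (2 * ((k : ℂ) + 1)))) =
      (1 / (2 * Real.pi) : ℂ) * ∫ t : ℝ,
        Complex.Gamma (1 - ((a : ℂ) + t * I)) * (x : ℂ) ^ ((a : ℂ) + t * I) /
          riemannZeta (2 * ((a : ℂ) + t * I)) := by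
  have hx' : (x : ℂ) ≠ 0 := ofReal_ne_zero.2 hx.ne'
  have hre (t : ℝ) : (2 * ((a : ℂ) + t * I)).re = 2 * a := by simp
  have hre1 (t : ℝ) : 1 < (2 * ((a : ℂ) + t * I)).re := by rw [hre]; linarith
  let G (t : ℝ) : ℂ := Gamma (1 - ((a : ℂ) + t * I)) * (x : ℂ) ^ ((a : ℂ) + t * I)
  have hcpow {y : ℂ} (hy : y ≠ 0) : Continuous fun t : ℝ ↦ y ^ (2 * ((a : ℂ) + t * I)) :=
    Continuous.const_cpow (by fun_prop) (.inl hy)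
  have hG : Integrable G := by
    refine (integrable_Gamma_one_sub ha').mul_bdd (c := x ^ a)
      (Continuous.const_cpow (by fun_prop) (.inl hx')).aestronglyMeasurable (.of_forall fun t ↦ ?_)
    simp [norm_cpow_eq_rpow_re_of_pos hx]
  let M (n : ℕ) (t : ℝ) : ℂ := LSeries.term (fun n ↦ (μ n : ℂ)) (2 * ((a : ℂ) + t * I)) n
  have hM (t : ℝ) : HasSum (M · t) (riemannZeta (2 * ((a : ℂ) + t * I)))⁻¹ :=
    hasSum_moebius_term_riemannZeta_inv (hre1 t)
  have hMle (n : ℕ) (t : ℝ) : ‖M n t‖ ≤ 1 / (n : ℝ) ^ (2 * a) := by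
    simpa only [hre] using norm_moebius_term_le (2 * ((a : ℂ) + t * I)) n
  have hsum : Summable fun n : ℕ ↦ 1 / (n : ℝ) ^ (2 * a) :=
    Real.summable_one_div_nat_rpow.2 (by linarith)
  have hMc (n : ℕ) : Continuous (M n) := by
    rcases eq_or_ne n 0 with rfl | hn
    · simpa [M] using continuous_const
    have hn' : (n : ℂ) ≠ 0 := by exact_mod_cast hn
    simp only [M, LSeries.term_of_ne_zero hn]
    exact continuous_const.div (hcpow hn') fun t ↦ by simp [cpow_eq_zero_iff, hn']
  have hzc : Continuous fun t : ℝ ↦ (riemannZeta (2 * ((a : ℂ) + t * I)))⁻¹ := by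
    simp only [← fun t ↦ (hM t).tsum_eq]
    exact continuous_tsum hMc hsum hMle
  have hF (n : ℕ) : Integrable fun t ↦ G t * M n t :=
    hG.mul_bdd (hMc n).aestronglyMeasurable (.of_forall (hMle n))
  have hint (n : ℕ) : (1 / (2 * Real.pi) : ℂ) * ∫ t, G t * M n t =
      (μ n : ℂ) * ((x / n ^ 2 : ℝ) * exp (-(x / n ^ 2 : ℝ))) := by
    rcases eq_or_ne n 0 with rfl | hn
    · simp [M]
    have hn0 : (0 : ℝ) < n := by exact_mod_cast Nat.pos_of_ne_zero hn
    rw [← integral_Gamma_one_sub_mul_cpow ha' (by positivity), mul_left_comm,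
      ← integral_const_mul (μ n : ℂ)]
    refine congrArg _ (integral_congr_ae (.of_forall fun t ↦ ?_))
    beta_reduce
    have h1 : (x : ℂ) = ((x / n ^ 2 : ℝ) : ℂ) * (((n : ℝ) ^ 2 : ℝ) : ℂ) := by
      push_cast
      field_simp
    have h2 : (((n : ℝ) ^ 2 : ℝ) : ℂ) ^ ((a : ℂ) + t * I) = (n : ℂ) ^ (2 * ((a : ℂ) + t * I)) := by
      push_cast
      rw [← natCast_cpow_natCast_mul]
      push_cast
      rfl
    have h3 : (n : ℂ) ^ (2 * ((a : ℂ) + t * I)) ≠ 0 := by simp [cpow_eq_zero_iff, hn]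
    simp only [G, M, LSeries.term_of_ne_zero hn]
    conv_lhs => rw [h1, mul_cpow_ofReal_nonneg (by positivity) (by positivity), h2]
    generalize (n : ℂ) ^ (2 * ((a : ℂ) + t * I)) = w at h3
    field_simp
  have hnorm : Summable fun n ↦ ∫ t, ‖G t * M n t‖ := by
    refine (hsum.mul_left (∫ t, ‖G t‖)).of_nonneg_of_le
      (fun n ↦ integral_nonneg fun _ ↦ norm_nonneg _) fun n ↦ ?_
    rw [← integral_mul_const]
    refine integral_mono (hF n).norm (hG.norm.mul_const _) fun t ↦ ?_
    simp only [norm_mul]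
    gcongr
    exact hMle n t
  refine ⟨?_, ?_⟩
  · simp only [div_eq_mul_inv]
    refine hG.mul_bdd (c := ∑' n : ℕ, 1 / (n : ℝ) ^ (2 * a)) hzc.aestronglyMeasurable
      (.of_forall fun t ↦ ?_)
    rw [← (hM t).tsum_eq]
    exact tsum_of_norm_bounded hsum.hasSum (hMle · t)
  · rw [tsum_riesz_eq_tsum_moebius]
    simp only [← hint]
    rw [tsum_mul_left, (hasSum_integral_of_summable_integral_norm hF hnorm).tsum_eq]
    refine congrArg _ (integral_congr_ae (.of_forall fun t ↦ ?_))
    beta_reduce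
    rw [tsum_mul_left, (hM t).tsum_eq, div_eq_mul_inv]
end
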